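/- For all τ1, τ2 ≥ 1, Var(S_{τ1+τ2}) = Var(S_{τ1}) + Var(S_{τ2}) + 2·f(τ1,τ2), where f(τ1,τ2) := ∑_{k=0}^{τ1+τ2−2} min(k+1, min(τ1,τ2), τ1+τ2−1−k)·C_k − τ1·τ2·μ² (for τ1 ≠ τ2 this coincides with the paper's form ∑_{k=0}^{θ−1}(k+1)·C_k + θ·∑_{k=θ}^{θ'−2} C_k + ∑_{k=θ'−1}^{τ1+τ2−2}(τ1+τ2−1−k)·C_k − τ1·τ2·μ², with θ = min(τ1,τ2), θ' = max(τ1,τ2)). This is the paper's Lemma 3.2, the general recursive relation for time transport correlations in abelian sandpile models. -/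

import Mathlib

open Finset

/-- Expectation with respect to the stationary path measure of length `τ`
(paths have `τ + 1` states). -/
noncomputable def pathE {S : Type*} [Fintype S] (P : S → S → ℝ) (pi : S → ℝ) (τ : ℕ)
    (f : (Fin (τ + 1) → S) → ℝ) : ℝ :=
  ∑ x : Fin (τ + 1) → S,
    (pi (x 0) * ∏ t : Fin τ, P (x t.castSucc) (x t.succ)) * f x

/-- Integrated transport `S_τ = ∑_{t=1}^{τ} u (x_{t-1}, x_t)` along a path. -/
noncomputable def intTrans {S : Type*} (u : S → S → ℝ) (τ : ℕ) (x : Fin (τ + 1) → S) : ℝ :=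
  ∑ t : Fin τ, u (x t.castSucc) (x t.succ)

/-- Stationary mean `μ = E[u (x₀, x₁)]`. -/
noncomputable def mu {S : Type*} [Fintype S] (P : S → S → ℝ) (pi : S → ℝ)
    (u : S → S → ℝ) : ℝ :=
  pathE P pi 1 fun x => u (x 0) (x 1)

/-- Time correlator `C_k = E[u (x₀, x₁) · u (x_{k+1}, x_{k+2})]`. -/
noncomputable def corr {S : Type*} [Fintype S] (P : S → S → ℝ) (pi : S → ℝ)
    (u : S → S → ℝ) (k : ℕ) : ℝ :=
  pathE P pi (k + 2) fun x =>
    u (x 0) (x 1) * u (x ⟨k + 1, by omega⟩) (x ⟨k + 2, by omega⟩)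

/-- Variance of the integrated transport `Var(S_τ)`. -/
noncomputable def varS {S : Type*} [Fintype S] (P : S → S → ℝ) (pi : S → ℝ)
    (u : S → S → ℝ) (τ : ℕ) : ℝ :=
  pathE P pi τ (fun x => (intTrans u τ x) ^ 2)
    - (pathE P pi τ (fun x => intTrans u τ x)) ^ 2

theorem intTrans_add {S : Type*} (u : S → S → ℝ) (m n : ℕ) (x : Fin (m + n + 1) → S) :
    intTrans u (m + n) x =
      intTrans u m (fun j => x ⟨0 + j, by omega⟩) +
        intTrans u n (fun j => x ⟨m + j, by omega⟩) := by
  simp only [intTrans, Fin.sum_univ_add, zero_add]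
  rfl

section PathExpectation

variable {S : Type*} [Fintype S] {P : S → S → ℝ} {pi : S → ℝ}

theorem pathE_add (n : ℕ) (f g : (Fin (n + 1) → S) → ℝ) :
    pathE P pi n (fun x => f x + g x) = pathE P pi n f + pathE P pi n g := by
  simp only [pathE, mul_add, Finset.sum_add_distrib]

theorem pathE_const_mul (n : ℕ) (c : ℝ) (f : (Fin (n + 1) → S) → ℝ) :
    pathE P pi n (fun x => c * f x) = c * pathE P pi n f := by
  simp only [pathE, Finset.mul_sum]
  exact Finset.sum_congr rfl fun x _ => by ring

theorem pathE_sum {ι : Type*} (s : Finset ι) (n : ℕ) (f : ι → (Fin (n + 1) → S) → ℝ) :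
    pathE P pi n (fun x => ∑ i ∈ s, f i x) = ∑ i ∈ s, pathE P pi n (f i) := by
  simp only [pathE, Finset.mul_sum]
  exact Finset.sum_comm

/-- The final state of a path can be summed out, since the kernel is row-stochastic. -/
theorem pathE_castSucc (hProw : ∀ r, ∑ r', P r r' = 1) (n : ℕ) (f : (Fin (n + 1) → S) → ℝ) :
    pathE P pi (n + 1) (fun x => f fun j => x j.castSucc) = pathE P pi n f := by
  unfold pathE
  rw [← (Fin.snocEquiv fun _ : Fin (n + 2) => S).sum_comp, Fintype.sum_prod_type_right]
  refine Finset.sum_congr rfl fun y _ => ?_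
  have hy (r : S) : (Fin.snocEquiv fun _ : Fin (n + 2) => S) (r, y) =
      Fin.snoc (α := fun _ => S) y r := rfl
  have h0 (r : S) : Fin.snoc (α := fun _ => S) y r 0 = y 0 :=
    Fin.snoc_castSucc (α := fun _ => S) r y 0
  simp only [hy, h0, Fin.prod_univ_castSucc, Fin.succ_castSucc, Fin.snoc_castSucc, Fin.succ_last,
    Fin.snoc_last]
  rw [← Finset.sum_mul, ← Finset.mul_sum, ← Finset.mul_sum, hProw, mul_one]

/-- The initial state of a path can be summed out, since `pi` is stationary. -/
theorem pathE_succ (hstat : ∀ r', ∑ r, pi r * P r r' = pi r') (n : ℕ)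
    (f : (Fin (n + 1) → S) → ℝ) :
    pathE P pi (n + 1) (fun x => f fun j => x j.succ) = pathE P pi n f := by
  unfold pathE
  rw [← (Fin.consEquiv fun _ : Fin (n + 2) => S).sum_comp, Fintype.sum_prod_type_right]
  refine Finset.sum_congr rfl fun y _ => ?_
  have hy (r : S) : (Fin.consEquiv fun _ : Fin (n + 2) => S) (r, y) =
      Fin.cons (α := fun _ => S) r y := rfl
  simp only [hy, Fin.prod_univ_succ, Fin.cons_zero, Fin.cons_succ, Fin.castSucc_zero,
    ← Fin.succ_castSucc, ← mul_assoc]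
  rw [← Finset.sum_mul, ← Finset.sum_mul, hstat]

/-- The path measure is stationary: every window of `m` consecutive steps has the law of a
path of length `m`. -/
theorem pathE_window (hProw : ∀ r, ∑ r', P r r' = 1)
    (hstat : ∀ r', ∑ r, pi r * P r r' = pi r') {a m n : ℕ} (h : a + m ≤ n)
    (f : (Fin (m + 1) → S) → ℝ) :
    pathE P pi n (fun x => f fun j => x ⟨a + j, by omega⟩) = pathE P pi m f := by
  induction n, h using Nat.le_induction with
  | base =>
    induction a with
    | zero =>
      have key : ∀ k (hk : k = m), pathE P pi k (fun x => f fun j => x ⟨0 + j, by omega⟩)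
          = pathE P pi m f := by
        rintro k rfl
        simp only [zero_add, Fin.eta]
      exact key _ (zero_add m)
    | succ a ih =>
      have key : ∀ k (hk : k = a + m + 1),
          pathE P pi k (fun x => f fun j => x ⟨a + 1 + j, by omega⟩) = pathE P pi m f := by
        rintro k rfl
        rw [← ih, ← pathE_succ hstat (a + m)]
        simp only [Fin.succ_mk, add_right_comm]
      exact key _ (by omega)
  | succ n hn ih =>
    rw [← ih, ← pathE_castSucc hProw n]
    rfl

theorem pathE_step (hProw : ∀ r, ∑ r', P r r' = 1)
    (hstat : ∀ r', ∑ r, pi r * P r r' = pi r') (u : S → S → ℝ) {i n : ℕ} (h : i < n) :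
    pathE P pi n (fun x => u (x ⟨i, by omega⟩) (x ⟨i + 1, by omega⟩)) = mu P pi u :=
  pathE_window hProw hstat (a := i) (m := 1) h fun x => u (x 0) (x 1)

theorem pathE_step_mul_step (hProw : ∀ r, ∑ r', P r r' = 1)
    (hstat : ∀ r', ∑ r, pi r * P r r' = pi r') (u : S → S → ℝ) {i j k n : ℕ}
    (hij : j = i + (k + 1)) (h : j < n) :
    pathE P pi n (fun x => u (x ⟨i, by omega⟩) (x ⟨i + 1, by omega⟩) *
      u (x ⟨j, by omega⟩) (x ⟨j + 1, by omega⟩)) = corr P pi u k := by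
  subst hij
  exact pathE_window hProw hstat (a := i) (m := k + 2) h fun x =>
    u (x 0) (x 1) * u (x ⟨k + 1, by omega⟩) (x ⟨k + 2, by omega⟩)

theorem pathE_intTrans (hProw : ∀ r, ∑ r', P r r' = 1)
    (hstat : ∀ r', ∑ r, pi r * P r r' = pi r') (u : S → S → ℝ) (n : ℕ) :
    pathE P pi n (fun x => intTrans u n x) = n * mu P pi u := by
  unfold intTrans
  rw [pathE_sum]
  have h (t : Fin n) : pathE P pi n (fun x => u (x t.castSucc) (x t.succ)) = mu P pi u :=
    pathE_step hProw hstat u t.isLt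
  simp [h]

/-- Mixed moment of the transports over two adjacent windows. -/
theorem pathE_intTrans_mul_intTrans (hProw : ∀ r, ∑ r', P r r' = 1)
    (hstat : ∀ r', ∑ r, pi r * P r r' = pi r') (u : S → S → ℝ) (m n : ℕ) :
    pathE P pi (m + n) (fun x =>
      intTrans u m (fun j => x ⟨0 + j, by omega⟩) *
        intTrans u n (fun j => x ⟨m + j, by omega⟩)) =
      ∑ i ∈ Finset.range m, ∑ j ∈ Finset.range n, corr P pi u (i + j) := by
  simp only [intTrans, Finset.sum_mul_sum, pathE_sum]
  rw [← Finset.sum_range_reflect, Finset.sum_range]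
  refine Finset.sum_congr rfl fun i _ => ?_
  rw [Finset.sum_range]
  refine Finset.sum_congr rfl fun j _ => ?_
  rw [← pathE_step_mul_step (n := m + n) hProw hstat u
    (show m + (j : ℕ) = i + (m - 1 - i + j + 1) by omega) (by omega)]
  simp only [zero_add]
  rfl

end PathExpectation

/-- Summation along the antidiagonals of an `a × b` rectangle. -/
theorem sum_range_sum_range_add (a b : ℕ) (hb : 1 ≤ b) (c : ℕ → ℝ) :
    ∑ i ∈ Finset.range a, ∑ j ∈ Finset.range b, c (i + j) =
      ∑ k ∈ Finset.range (a + b - 1),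
        ((min (k + 1) (min (min a b) (a + b - 1 - k)) : ℕ) : ℝ) * c k := by
  have hrow : ∀ i ∈ Finset.range a, ∑ j ∈ Finset.range b, c (i + j) =
      ∑ k ∈ Finset.range (a + b - 1), if i ≤ k ∧ k < i + b then c k else 0 := by
    intro i hi
    rw [Finset.mem_range] at hi
    rw [← Finset.sum_filter]
    have hIco : (Finset.range (a + b - 1)).filter (fun k => i ≤ k ∧ k < i + b) =
        Finset.Ico i (i + b) := by
      ext k
      simp only [Finset.mem_filter, Finset.mem_range, Finset.mem_Ico]
      omega
    rw [hIco, Finset.sum_Ico_eq_sum_range, Nat.add_sub_cancel_left]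
  rw [Finset.sum_congr rfl hrow, Finset.sum_comm]
  refine Finset.sum_congr rfl fun k hk => ?_
  rw [Finset.mem_range] at hk
  rw [← Finset.sum_filter, Finset.sum_const, nsmul_eq_mul]
  have hIco : (Finset.range a).filter (fun i => i ≤ k ∧ k < i + b) =
      Finset.Ico (k + 1 - b) (min a (k + 1)) := by
    ext i
    simp only [Finset.mem_filter, Finset.mem_range, Finset.mem_Ico]
    omega
  rw [hIco, Nat.card_Ico]
  congr 2
  omega

/-- Lemma 3.2 (general recursive relation for time transport correlations): for all
`τ1, τ2 ≥ 1`, `Var(S_{τ1+τ2}) = Var(S_{τ1}) + Var(S_{τ2}) + 2 f(τ1,τ2)` with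
`f(τ1,τ2) = ∑_{k=0}^{τ1+τ2-2} min(k+1, min(τ1,τ2), τ1+τ2-1-k) C_k - τ1 τ2 μ²`. -/
theorem recursive_relation_time_transport_correlations
    {S : Type*} [Fintype S] [Nonempty S]
    (P : S → S → ℝ) (pi : S → ℝ) (u : S → S → ℝ)
    (hP : ∀ r r', 0 ≤ P r r') (hProw : ∀ r, ∑ r', P r r' = 1)
    (hpi : ∀ r, 0 ≤ pi r) (hpisum : ∑ r, pi r = 1)
    (hstat : ∀ r', ∑ r, pi r * P r r' = pi r')
    (τ1 τ2 : ℕ) (h1 : 1 ≤ τ1) (h2 : 1 ≤ τ2) :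
    varS P pi u (τ1 + τ2) =
      varS P pi u τ1 + varS P pi u τ2 +
        2 * ((∑ k ∈ Finset.range (τ1 + τ2 - 1),
            ((min (k + 1) (min (min τ1 τ2) (τ1 + τ2 - 1 - k)) : ℕ) : ℝ) * corr P pi u k)
          - (τ1 : ℝ) * (τ2 : ℝ) * (mu P pi u) ^ 2) := by
  have hsq : pathE P pi (τ1 + τ2) (fun x => intTrans u (τ1 + τ2) x ^ 2) =
      pathE P pi τ1 (fun x => intTrans u τ1 x ^ 2) +
        pathE P pi τ2 (fun x => intTrans u τ2 x ^ 2) +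
        2 * ∑ i ∈ Finset.range τ1, ∑ j ∈ Finset.range τ2, corr P pi u (i + j) := by
    rw [← pathE_intTrans_mul_intTrans hProw hstat,
      ← pathE_window hProw hstat (a := 0) (n := τ1 + τ2) (by omega)
        (fun x => intTrans u τ1 x ^ 2),
      ← pathE_window hProw hstat (a := τ1) le_rfl (fun x => intTrans u τ2 x ^ 2),
      ← pathE_const_mul, ← pathE_add, ← pathE_add]
    congr 1
    funext x
    rw [intTrans_add]
    ring
  simp only [varS]
  rw [hsq, pathE_intTrans hProw hstat, pathE_intTrans hProw hstat, pathE_intTrans hProw hstat,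
    sum_range_sum_range_add τ1 τ2 h2]
  push_cast
  ring
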